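/- arXiv:2103.07258 — 2 statements merged into one kernel-verified Lean document; each statement's English description precedes it below -/
import Mathlib

section
/- Two squares that are each strictly larger than the critical size cannot be packed into the unit disk: if a > 2/√5 and b > 2/√5, then there do not exist isometries f, g of ℝ² such that f([0,a]×[0,a]) ⊆ D, g([0,b]×[0,b]) ⊆ D, and the interiors of f([0,a]×[0,a]) and g([0,b]×[0,b]) are disjoint. -/
noncomputable section
open Set Metric

abbrev Plane := EuclideanSpace ℝ (Fin 2)

def unitDisk : Set Plane := closedBall 0 1

def stdSquare (s : ℝ) : Set Plane := {p | p 0 ∈ Icc 0 s ∧ p 1 ∈ Icc 0 s}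

/-- If the corners of `[0, a] × [0, a]` with `a > 2 / √5` are within distance `1` of `(u, v)`,
then `u` lies strictly between `0` and `a`. -/
lemma center_mem_Ioo {a u v : ℝ} (ha : 2 / Real.sqrt 5 < a)
    (h00 : u ^ 2 + v ^ 2 ≤ 1) (h10 : (a - u) ^ 2 + v ^ 2 ≤ 1)
    (h01 : u ^ 2 + (a - v) ^ 2 ≤ 1) (h11 : (a - u) ^ 2 + (a - v) ^ 2 ≤ 1) :
    u ∈ Ioo 0 a := by
  have h5 : (0 : ℝ) < Real.sqrt 5 := by positivity
  have ha0 : 0 < a := lt_trans (by positivity) ha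
  have ha2 : 4 < 5 * a ^ 2 := by
    have h : 2 < a * Real.sqrt 5 := (div_lt_iff₀ h5).1 ha
    have hs : Real.sqrt 5 ^ 2 = 5 := Real.sq_sqrt (by norm_num)
    nlinarith
  constructor <;> by_contra! hu
  · nlinarith [sq_nonneg (a - 2 * v), mul_nonneg ha0.le (neg_nonneg.2 hu)]
  · nlinarith [sq_nonneg (a - 2 * v), mul_nonneg ha0.le (sub_nonneg.2 hu)]

lemma mem_interior_stdSquare {a : ℝ} {p : Plane} (h0 : p 0 ∈ Ioo 0 a) (h1 : p 1 ∈ Ioo 0 a) :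
    p ∈ interior (stdSquare a) := by
  refine mem_interior.2 ⟨{q | q 0 ∈ Ioo 0 a} ∩ {q | q 1 ∈ Ioo 0 a}, ?_, ?_, h0, h1⟩
  · exact fun q hq => ⟨Ioo_subset_Icc_self hq.1, Ioo_subset_Icc_self hq.2⟩
  · exact (isOpen_Ioo.preimage (by fun_prop)).inter (isOpen_Ioo.preimage (by fun_prop))

/-- A square of side larger than `2 / √5` inside the unit disk has the origin in its interior. -/
lemma zero_mem_interior_of_subset_unitDisk {a : ℝ} (ha : 2 / Real.sqrt 5 < a)
    (f : Plane ≃ᵢ Plane) (hf : f '' stdSquare a ⊆ unitDisk) :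
    (0 : Plane) ∈ interior (f '' stdSquare a) := by
  have ha0 : 0 ≤ a := le_trans (by positivity) ha.le
  obtain ⟨c, hc⟩ := f.surjective 0
  have key (x y : ℝ) (hx : x ∈ Icc 0 a) (hy : y ∈ Icc 0 a) :
      (x - c 0) ^ 2 + (y - c 1) ^ 2 ≤ 1 := by
    have h : dist (f !₂[x, y]) 0 ≤ 1 :=
      hf (mem_image_of_mem f (show !₂[x, y] ∈ stdSquare a from ⟨hx, hy⟩))
    rw [← hc, f.isometry.dist_eq, EuclideanSpace.dist_eq, Real.sqrt_le_iff] at h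
    simpa [Fin.sum_univ_two, Real.dist_eq, sq_abs] using h
  have hl : (0 : ℝ) ∈ Icc 0 a := left_mem_Icc.2 ha0
  have hr : a ∈ Icc 0 a := right_mem_Icc.2 ha0
  have h00 := key 0 0 hl hl
  have h10 := key a 0 hr hl
  have h01 := key 0 a hl hr
  have h11 := key a a hr hr
  have hmem : c ∈ interior (stdSquare a) :=
    mem_interior_stdSquare
      (center_mem_Ioo (v := c 1) ha (by linarith) (by linarith) (by linarith) (by linarith))
      (center_mem_Ioo (v := c 0) ha (by linarith) (by linarith) (by linarith) (by linarith))
  have himg := f.toHomeomorph.image_interior (stdSquare a)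
  simp only [IsometryEquiv.coe_toHomeomorph] at himg
  rw [← himg]
  exact ⟨c, hmem, hc⟩

theorem two_large_squares_cannot_pack (a b : ℝ)
    (ha : 2 / Real.sqrt 5 < a) (hb : 2 / Real.sqrt 5 < b) :
    ¬ ∃ f g : Plane ≃ᵢ Plane,
      f '' stdSquare a ⊆ unitDisk ∧ g '' stdSquare b ⊆ unitDisk ∧
      Disjoint (interior (f '' stdSquare a)) (interior (g '' stdSquare b)) := by
  rintro ⟨f, g, hf, hg, hd⟩
  exact disjoint_left.1 hd (zero_mem_interior_of_subset_unitDisk ha f hf)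
    (zero_mem_interior_of_subset_unitDisk hb g hg)
end
end

section
/- For every s₁ with 0.295 ≤ s₁ ≤ √(8/5) and √(1 − T⁻¹(s₁)²) − s₁/2 ≤ s₁, the point (x₊₂, y₊₂) lies in the closed unit disk, i.e. x₊₂² + y₊₂² ≤ 1, where x₊₂ := s₁/2 + 0.645·σ(s₁) and y₊₂ := T⁻¹(s₁) + 2·0.645·σ(s₁) if s₁ ≤ s₁*, while y₊₂ := −σ(s₁)/2 + 2·0.645·σ(s₁) if s₁ > s₁*. -/
noncomputable section

/-- T⁻¹(s) = √(1 − s²/4) − s. -/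
def Tinv (s : ℝ) : ℝ := Real.sqrt (1 - s ^ 2 / 4) - s

/-- T(u) = (2/5)(√(5 − u²) − 2u). -/
def Tfun (u : ℝ) : ℝ := 2 / 5 * (Real.sqrt (5 - u ^ 2) - 2 * u)

/-- s₁* = √((2 + √2)/3). -/
def s1star : ℝ := Real.sqrt ((2 + Real.sqrt 2) / 3)

/-- σ(s₁), the side length of the largest square fitting into a side pocket. -/
def sigma (s₁ : ℝ) : ℝ :=
  if s₁ ≤ s1star then
    1 / 4 * (-s₁ - 2 * Tinv s₁ + Real.sqrt (8 - (s₁ - 2 * Tinv s₁) ^ 2))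
  else
    1 / 5 * (Real.sqrt (20 - s₁ ^ 2) - 2 * s₁)

/-- w(y_t, h) = 2√(min{1 − y_t², 1 − (y_t − h)²}). -/
def wfun (yt h : ℝ) : ℝ := 2 * Real.sqrt (min (1 - yt ^ 2) (1 - (yt - h) ^ 2))

/-- X(a, b, u). -/
def Xfun (a b u : ℝ) : ℝ :=
  if u ≤ 2 * min a (-b) then Tinv u else Real.sqrt (1 - (u - min a (-b)) ^ 2) - u

/-- Y(a, h, w, h′) = w/2 − h + X(a, a − h, h′). -/
def Yfun (a h w h' : ℝ) : ℝ := w / 2 - h + Xfun a (a - h) h'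

/-- B₁(h, w, h′). -/
def B1 (h w h' : ℝ) : ℝ :=
  max (h * w / 2 + h ^ 2 / 4) (max (h ^ 2 + (w - h - h') * h') (h * (w + h) / 2 - h' ^ 2))

/-- B₂(h, w, h′). -/
def B2 (h w h' : ℝ) : ℝ :=
  if w < h + h' then h ^ 2
  else if w < 2 * h then h ^ 2 + h' ^ 2
  else B1 h w h'

/-- B₃(a, h, w, h′). -/
def B3 (a h w h' : ℝ) : ℝ :=
  max (h ^ 2 + max (Yfun a h w h') 0 * h')
      (h ^ 2 + min (max (Yfun a h w h') 0 ^ 2) (2 * h' ^ 2))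

/-- B₄(a, h, w, h′). -/
def B4 (a h w h' : ℝ) : ℝ := max (B2 h w h') (B3 a h w h')

/-- E(s₁, sₙ). -/
def Efun (s₁ sn : ℝ) : ℝ := if sn ≤ sigma s₁ then 0.83 * sigma s₁ ^ 2 else 0

/-- A(δ), the area of a circular segment of the unit disk of height δ. -/
def Aseg (δ : ℝ) : ℝ := Real.arccos (1 - δ) - (1 - δ) * Real.sqrt (1 - (1 - δ) ^ 2)

/-- B₅(h, H) = A(H − h) + h² − H·h. -/
def B5 (h H : ℝ) : ℝ := Aseg (H - h) + h ^ 2 - H * h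

/-- B₆(H_R, W_R, h′) = H_R·W_R/2 + h′·H_R/4. -/
def B6 (HR WR h' : ℝ) : ℝ := HR * WR / 2 + h' * HR / 4

/-- The condition on the width of the largest square confines `s` to `s² ≥ 2/5`. -/
theorem two_fifths_le_sq {s : ℝ} (hs : 0 < s) (hs' : s ^ 2 ≤ 4)
    (h : Real.sqrt (1 - Tinv s ^ 2) - s / 2 ≤ s) : 2 / 5 ≤ s ^ 2 := by
  have hR : 0 ≤ Real.sqrt (1 - s ^ 2 / 4) := Real.sqrt_nonneg _
  have hR2 : Real.sqrt (1 - s ^ 2 / 4) ^ 2 = 1 - s ^ 2 / 4 := Real.sq_sqrt (by linarith)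
  have h1 : 1 - Tinv s ^ 2 ≤ (3 / 2 * s) ^ 2 := by
    rw [← Real.sqrt_le_left (by positivity)]
    linarith
  rw [Tinv] at h1
  have h2 : s * (2 * Real.sqrt (1 - s ^ 2 / 4)) ≤ s * (3 * s) := by nlinarith
  have h3 := le_of_mul_le_mul_left h2 hs
  nlinarith

/-- The far corner `(s / 2 + x, T + x)` of the square of side `x` at `(s / 2, T)` lies on
the unit circle. -/
theorem diagonal_corner_on_circle {s T x : ℝ} (h : (s - 2 * T) ^ 2 ≤ 8)
    (hx : x = 1 / 4 * (-s - 2 * T + Real.sqrt (8 - (s - 2 * T) ^ 2))) :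
    (s / 2 + x) ^ 2 + (T + x) ^ 2 = 1 := by
  have h8 : Real.sqrt (8 - (s - 2 * T) ^ 2) ^ 2 = 8 - (s - 2 * T) ^ 2 :=
    Real.sq_sqrt (by linarith)
  rw [show Real.sqrt (8 - (s - 2 * T) ^ 2) = 4 * x + s + 2 * T by linarith] at h8
  nlinarith

theorem le_of_one_le_diagonal {s T x c : ℝ} (h : (s / 2 + x) ^ 2 + (T + x) ^ 2 = 1)
    (hpos : 0 < s + 2 * T + 2 * c + 2 * x)
    (hc : 1 ≤ (s / 2 + c) ^ 2 + (T + c) ^ 2) : x ≤ c := by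
  by_contra! hlt
  nlinarith [mul_pos (sub_pos.2 hlt) hpos]

theorem s1star_le : s1star ≤ 1.067 := by
  have h2 : Real.sqrt 2 ≤ 1.4143 := Real.sqrt_le_iff.2 (by norm_num)
  exact Real.sqrt_le_iff.2 ⟨by norm_num, by linarith⟩

theorem le_s1star : 1.066 ≤ s1star := by
  have h2 : 1.414 ≤ Real.sqrt 2 := Real.le_sqrt_of_sq_le (by norm_num)
  exact Real.le_sqrt_of_sq_le (by linarith)

/-- The inequality for the branch `s ≤ s1star`, in terms of `R = √(1 - s² / 4)`. -/
theorem lower_branch_in_disk {s R x : ℝ} (hs : 0.632 ≤ s) (hs' : s ≤ 1.067) (hR : 0 ≤ R)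
    (hR2 : R ^ 2 = 1 - s ^ 2 / 4) (hx : 0 ≤ x)
    (hc : (s / 2 + x) ^ 2 + (R - s + x) ^ 2 = 1) :
    (s / 2 + 0.645 * x) ^ 2 + (R - s + 2 * (0.645 * x)) ^ 2 ≤ 1 := by
  have hRu : R ≤ 1.0541 - s / 6 := by
    refine abs_le_of_sq_le_sq' ?_ (by linarith) |>.2
    linarith [sq_nonneg (s - 0.6325)]
  have hRl : 0.84 ≤ R := by
    refine abs_le_of_sq_le_sq' ?_ hR |>.2
    nlinarith
  have of_le : ∀ c : ℝ, x ≤ c → 0.39 ≤ c →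
      (s / 2 + 0.645 * c) ^ 2 + (1.0541 - s / 6 - s + 2 * (0.645 * c)) ^ 2 ≤ 1 →
      (s / 2 + 0.645 * x) ^ 2 + (R - s + 2 * (0.645 * x)) ^ 2 ≤ 1 := by
    intro c hxc h39 h
    have h1 : (s / 2 + 0.645 * x) ^ 2 ≤ (s / 2 + 0.645 * c) ^ 2 :=
      sq_le_sq' (by linarith) (by linarith)
    have h2 : (R - s + 2 * (0.645 * x)) ^ 2 ≤ (1.0541 - s / 6 - s + 2 * (0.645 * c)) ^ 2 :=
      sq_le_sq' (by linarith) (by linarith)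
    linarith
  rcases le_total s 0.8 with h8 | h8
  · have hchord : 1.07 - 0.192 * s ≤ R := by
      refine abs_le_of_sq_le_sq' ?_ hR |>.2
      linarith [mul_nonneg (sub_nonneg.2 hs) (sub_nonneg.2 h8)]
    have hxc : x ≤ 0.3915 + 0.33 * (s - 0.632) := by
      apply le_of_one_le_diagonal hc <;> try linarith
      have h3 : (1.07 - 0.192 * s - s + (0.3915 + 0.33 * (s - 0.632))) ^ 2 ≤
          (R - s + (0.3915 + 0.33 * (s - 0.632))) ^ 2 := sq_le_sq' (by linarith) (by linarith)
      linarith [sq_nonneg (s - 0.648)]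
    apply of_le _ hxc (by linarith)
    linarith [mul_nonneg (sub_nonneg.2 hs) (sub_nonneg.2 h8)]
  · have hchord : 1.1284 - 0.2649 * s ≤ R := by
      refine abs_le_of_sq_le_sq' ?_ hR |>.2
      linarith [mul_nonneg (sub_nonneg.2 h8) (sub_nonneg.2 hs')]
    have hxc : x ≤ 0.453 := by
      apply le_of_one_le_diagonal hc <;> try linarith
      have h3 : (1.1284 - 0.2649 * s - s + 0.453) ^ 2 ≤ (R - s + 0.453) ^ 2 :=
        sq_le_sq' (by linarith) (by linarith)
      linarith [sq_nonneg (s - 0.959)]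
    apply of_le _ hxc (by linarith)
    linarith [mul_nonneg (sub_nonneg.2 h8) (sub_nonneg.2 hs')]

/-- The inequality for the branch `s > s1star`. -/
theorem upper_branch_in_disk {s : ℝ} (hs : 1.066 ≤ s) (hs' : s ^ 2 ≤ 8 / 5) :
    (s / 2 + 0.645 * (1 / 5 * (Real.sqrt (20 - s ^ 2) - 2 * s))) ^ 2 +
      (-(1 / 5 * (Real.sqrt (20 - s ^ 2) - 2 * s)) / 2 +
        2 * (0.645 * (1 / 5 * (Real.sqrt (20 - s ^ 2) - 2 * s)))) ^ 2 ≤ 1 := by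
  have hs1 : s ≤ 1.27 := by nlinarith
  have hl : 4 ≤ Real.sqrt (20 - s ^ 2) := Real.le_sqrt_of_sq_le (by linarith)
  have hu : Real.sqrt (20 - s ^ 2) ≤ 4.35 := Real.sqrt_le_iff.2 ⟨by norm_num, by nlinarith⟩
  set x := 1 / 5 * (Real.sqrt (20 - s ^ 2) - 2 * s) with hx
  have h1 : (s / 2 + 0.645 * x) ^ 2 ≤ 0.88 ^ 2 := sq_le_sq' (by linarith) (by linarith)
  have h2 : (-x / 2 + 2 * (0.645 * x)) ^ 2 ≤ 0.36 ^ 2 := sq_le_sq' (by linarith) (by linarith)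
  linarith

theorem top_packing_point_two_in_disk (s₁ : ℝ)
    (h₁ : 0.295 ≤ s₁) (h₂ : s₁ ≤ Real.sqrt (8 / 5))
    (hℓ : Real.sqrt (1 - Tinv s₁ ^ 2) - s₁ / 2 ≤ s₁) :
    (s₁ / 2 + 0.645 * sigma s₁) ^ 2 +
      (if s₁ ≤ s1star then Tinv s₁ + 2 * (0.645 * sigma s₁)
       else -(sigma s₁) / 2 + 2 * (0.645 * sigma s₁)) ^ 2 ≤ 1 := by
  have hs0 : 0 < s₁ := by linarith
  have hs2 : s₁ ^ 2 ≤ 8 / 5 := (Real.le_sqrt hs0.le (by norm_num)).1 h₂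
  have hlo := two_fifths_le_sq hs0 (by linarith) hℓ
  have hlo' : 0.632 ≤ s₁ := by nlinarith
  by_cases h : s₁ ≤ s1star
  · have hhi := h.trans s1star_le
    have hR2 : Real.sqrt (1 - s₁ ^ 2 / 4) ^ 2 = 1 - s₁ ^ 2 / 4 := Real.sq_sqrt (by linarith)
    have hR := Real.sqrt_nonneg (1 - s₁ ^ 2 / 4)
    have hR1 : Real.sqrt (1 - s₁ ^ 2 / 4) ≤ 1 := Real.sqrt_le_one.2 (by nlinarith)
    have hR0 : 0.84 ≤ Real.sqrt (1 - s₁ ^ 2 / 4) := Real.le_sqrt_of_sq_le (by nlinarith)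
    have hT : Tinv s₁ ^ 2 ≤ 0.4 ^ 2 :=
      sq_le_sq' (by rw [Tinv]; linarith) (by rw [Tinv]; linarith)
    have hsig : sigma s₁ = 1 / 4 * (-s₁ - 2 * Tinv s₁ +
        Real.sqrt (8 - (s₁ - 2 * Tinv s₁) ^ 2)) := if_pos h
    have hx : 0 ≤ sigma s₁ := by
      have : s₁ + 2 * Tinv s₁ ≤ Real.sqrt (8 - (s₁ - 2 * Tinv s₁) ^ 2) :=
        Real.le_sqrt_of_sq_le (by linarith)
      linarith
    have hc := diagonal_corner_on_circle
      (by linarith [sq_nonneg (s₁ + 2 * Tinv s₁)]) hsig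
    rw [if_pos h]
    exact lower_branch_in_disk hlo' hhi hR hR2 hx hc
  · rw [if_neg h, sigma, if_neg h]
    exact upper_branch_in_disk (le_s1star.trans (not_le.1 h).le) hs2
end
end
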